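/- Let L be a tabular quasi-normal modal logic with the Craig interpolation property. There exist polynomials p and q (depending only on L) such that: for every monotone function f : ℕ → ℕ, if every tautological propositional implication χ₁→χ₂ has a propositional Craig interpolant of dag-size at most f(|χ₁→χ₂|), then every modal implication φ→ψ ∈ L has a Craig interpolant in L of dag-size at most p(f(q(|φ|+|ψ|))). -/

import Mathlib

inductive MForm (α : Type) : Type
  | top : MForm α
  | atom : α → MForm α
  | neg : MForm α → MForm α
  | and : MForm α → MForm α → MForm α
  | box : MForm α → MForm α
deriving DecidableEq

namespace MForm

def imp {α : Type} (φ ψ : MForm α) : MForm α := neg (and φ (neg ψ))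

def dia {α : Type} (φ : MForm α) : MForm α := neg (box (neg φ))

def sig {α : Type} [DecidableEq α] : MForm α → Finset α
  | top => ∅
  | atom p => {p}
  | neg φ => sig φ
  | and φ ψ => sig φ ∪ sig ψ
  | box φ => sig φ

def IsProp {α : Type} : MForm α → Prop
  | top => True
  | atom _ => True
  | neg φ => IsProp φ
  | and φ ψ => IsProp φ ∧ IsProp ψ
  | box _ => False

def subf {α : Type} [DecidableEq α] : MForm α → Finset (MForm α)
  | top => {top}
  | atom p => {atom p}
  | neg φ => insert (neg φ) (subf φ)
  | and φ ψ => insert (and φ ψ) (subf φ ∪ subf ψ)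
  | box φ => insert (box φ) (subf φ)

/-- The dag-size of a formula: the number of its distinct subformulas. -/
def dagSize {α : Type} [DecidableEq α] (φ : MForm α) : ℕ := (subf φ).card

end MForm

def psat {α : Type} (v : α → Prop) : MForm α → Prop
  | .top => True
  | .atom p => v p
  | .neg φ => ¬ psat v φ
  | .and φ ψ => psat v φ ∧ psat v ψ
  | .box _ => True

/-- Propositional tautology. -/
def PTaut {α : Type} (φ : MForm α) : Prop := ∀ v : α → Prop, psat v φ

def bigAnd {α : Type} : List (MForm α) → MForm α
  | [] => .top
  | φ :: l => .and φ (bigAnd l)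

def bigOr {α : Type} (l : List (MForm α)) : MForm α := .neg (bigAnd (l.map .neg))

def boxIter {α : Type} : ℕ → MForm α → MForm α
  | 0, φ => φ
  | n + 1, φ => .box (boxIter n φ)

def diaIter {α : Type} : ℕ → MForm α → MForm α
  | 0, φ => φ
  | n + 1, φ => MForm.dia (diaIter n φ)

/-- `□^{≤n} φ`. -/
def ble {α : Type} (n : ℕ) (φ : MForm α) : MForm α :=
  bigAnd ((List.range (n + 1)).map (fun k => boxIter k φ))

/-- `◇^{≤n} φ`. -/
def dle {α : Type} (n : ℕ) (φ : MForm α) : MForm α := .neg (ble n (.neg φ))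

def substAtoms {α β : Type} (s : α → MForm β) : MForm α → MForm β
  | .top => .top
  | .atom a => s a
  | .neg φ => .neg (substAtoms s φ)
  | .and φ ψ => .and (substAtoms s φ) (substAtoms s ψ)
  | .box φ => .box (substAtoms s φ)


/-- A finite pointed frame. -/
structure PFin where
  W : Type
  fin : Fintype W
  R : W → W → Prop
  pt : W

attribute [instance] PFin.fin

def sat (F : PFin) (V : F.W → ℕ → Prop) : F.W → MForm ℕ → Prop
  | _, .top => True
  | w, .atom p => V w p
  | w, .neg φ => ¬ sat F V w φ
  | w, .and φ ψ => sat F V w φ ∧ sat F V w ψ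
  | w, .box φ => ∀ v, F.R w v → sat F V v φ

/-- The logic determined by a family of finite pointed frames. -/
def Log {ι : Type} (Fr : ι → PFin) : Set (MForm ℕ) :=
  {φ | ∀ i, ∀ V : (Fr i).W → ℕ → Prop, sat (Fr i) V (Fr i).pt φ}

/-- A tabular (quasi-normal) modal logic: the logic of a finite set of finite pointed
frames. -/
def Tabular (L : Set (MForm ℕ)) : Prop :=
  ∃ (ι : Type) (_ : Fintype ι) (Fr : ι → PFin), L = Log Fr

def StrImp (L : Set (MForm ℕ)) (σ : Finset ℕ) (φ χ : MForm ℕ) : Prop :=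
  χ.sig ⊆ σ ∧ φ.imp χ ∈ L ∧
    ∀ ψ : MForm ℕ, ψ.sig ⊆ σ → φ.imp ψ ∈ L → χ.imp ψ ∈ L

def CraigInt (L : Set (MForm ℕ)) (φ ψ χ : MForm ℕ) : Prop :=
  φ.imp χ ∈ L ∧ χ.imp ψ ∈ L ∧ χ.sig ⊆ φ.sig ∩ ψ.sig

def HasCIP (L : Set (MForm ℕ)) : Prop :=
  ∀ φ ψ : MForm ℕ, φ.imp ψ ∈ L → ∃ χ, CraigInt L φ ψ χ

/-- Uniform propositional `σ'`-interpolant. -/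
def UPropInt {β : Type} [DecidableEq β] (σ' : Finset β) (χ ξ : MForm β) : Prop :=
  ξ.IsProp ∧ ξ.sig ⊆ σ' ∧ PTaut (χ.imp ξ) ∧
    ∀ ψ : MForm β, ψ.IsProp → ψ.sig ∩ χ.sig ⊆ σ' → PTaut (χ.imp ψ) → PTaut (ξ.imp ψ)

/-- Propositional Craig interpolant for a tautological implication. -/
def PCraig {β : Type} [DecidableEq β] (χ₁ χ₂ ξ : MForm β) : Prop :=
  ξ.IsProp ∧ ξ.sig ⊆ χ₁.sig ∩ χ₂.sig ∧ PTaut (χ₁.imp ξ) ∧ PTaut (ξ.imp χ₂)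


namespace TabInt

open MForm

/-- Kripke satisfaction over an arbitrary set of atoms. -/
def gsat {α W : Type} (R : W → W → Prop) (V : W → α → Prop) : W → MForm α → Prop
  | _, .top => True
  | w, .atom p => V w p
  | w, .neg φ => ¬ gsat R V w φ
  | w, .and φ ψ => gsat R V w φ ∧ gsat R V w ψ
  | w, .box φ => ∀ v, R w v → gsat R V v φ

theorem sat_eq_gsat (F : PFin) (V : F.W → ℕ → Prop) (φ : MForm ℕ) :
    ∀ w, sat F V w φ ↔ gsat F.R V w φ := by
  induction φ with
  | top => intro w; simp [sat, gsat]
  | atom p => intro w; simp [sat, gsat]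
  | neg φ ih => intro w; simp [sat, gsat, ih]
  | and φ ψ ih ih' => intro w; simp [sat, gsat, ih, ih']
  | box φ ih => intro w; simp [sat, gsat, ih]

theorem gsat_subst {α β W : Type} (R : W → W → Prop) (V : W → β → Prop) (s : α → MForm β)
    (φ : MForm α) : ∀ w, gsat R V w (substAtoms s φ) ↔
      gsat R (fun x a => gsat R V x (s a)) w φ := by
  induction φ with
  | top => intro w; simp [substAtoms, gsat]
  | atom p => intro w; simp [substAtoms, gsat]
  | neg φ ih => intro w; simp [substAtoms, gsat, ih]
  | and φ ψ ih ih' => intro w; simp [substAtoms, gsat, ih, ih']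
  | box φ ih => intro w; simp [substAtoms, gsat, ih]

theorem gsat_bigAnd {α W : Type} (R : W → W → Prop) (V : W → α → Prop) (w : W)
    (l : List (MForm α)) : gsat R V w (bigAnd l) ↔ ∀ φ ∈ l, gsat R V w φ := by
  induction l with
  | nil => simp [bigAnd, gsat]
  | cons a l ih => simp [bigAnd, gsat, ih]

theorem gsat_bigOr {α W : Type} (R : W → W → Prop) (V : W → α → Prop) (w : W)
    (l : List (MForm α)) : gsat R V w (bigOr l) ↔ ∃ φ ∈ l, gsat R V w φ := by
  simp [bigOr, gsat, gsat_bigAnd]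

theorem gsat_imp {α W : Type} (R : W → W → Prop) (V : W → α → Prop) (w : W)
    (φ ψ : MForm α) : gsat R V w (φ.imp ψ) ↔ (gsat R V w φ → gsat R V w ψ) := by
  simp [MForm.imp, gsat]

theorem psat_imp {α : Type} (v : α → Prop)
    (φ ψ : MForm α) : psat v (φ.imp ψ) ↔ (psat v φ → psat v ψ) := by
  simp [MForm.imp, psat]

theorem psat_bigAnd {α : Type} (v : α → Prop)
    (l : List (MForm α)) : psat v (bigAnd l) ↔ ∀ φ ∈ l, psat v φ := by
  induction l with
  | nil => simp [bigAnd, psat]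
  | cons a l ih => simp [bigAnd, psat, ih]

/-- Invariance of satisfaction under bisimulations for the atoms of a formula. -/
theorem bisim {α W W' : Type} [DecidableEq α] (R : W → W → Prop) (R' : W' → W' → Prop)
    (V : W → α → Prop) (V' : W' → α → Prop) (Z : W → W' → Prop)
    (forth : ∀ x y x', Z x y → R x x' → ∃ y', R' y y' ∧ Z x' y')
    (back : ∀ x y y', Z x y → R' y y' → ∃ x', R x x' ∧ Z x' y')
    (φ : MForm α) : (∀ x y, Z x y → ∀ a ∈ φ.sig, (V x a ↔ V' y a)) →
      ∀ x y, Z x y → (gsat R V x φ ↔ gsat R' V' y φ) := by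
  induction φ with
  | top => intro _ x y _; simp [gsat]
  | atom p => intro h x y hz; simpa [gsat] using h x y hz p (by simp [sig])
  | neg φ ih => intro h x y hz; simp [gsat, ih h x y hz]
  | and φ ψ ih ih' =>
    intro h x y hz
    simp only [gsat]
    rw [ih (fun x y hz a ha => h x y hz a (by simp [sig, ha])) x y hz,
      ih' (fun x y hz a ha => h x y hz a (by simp [sig, ha])) x y hz]
  | box φ ih =>
    intro h x y hz
    simp only [gsat]
    constructor
    · intro H y' hy
      obtain ⟨x', hx, hz'⟩ := back x y y' hz hy
      exact (ih h x' y' hz').1 (H x' hx)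
    · intro H x' hx
      obtain ⟨y', hy, hz'⟩ := forth x y x' hz hx
      exact (ih h x' y' hz').2 (H y' hy)

theorem psat_congr {α : Type} [DecidableEq α] (v v' : α → Prop) (φ : MForm α) :
    (∀ a ∈ φ.sig, (v a ↔ v' a)) → (psat v φ ↔ psat v' φ) := by
  induction φ with
  | top => intro _; simp [psat]
  | atom p => intro h; simpa [psat] using h p (by simp [sig])
  | neg φ ih => intro h; simp [psat, ih h]
  | and φ ψ ih ih' =>
    intro h
    simp only [psat]
    rw [ih (fun a ha => h a (by simp [sig, ha])), ih' (fun a ha => h a (by simp [sig, ha]))]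
  | box φ ih => intro _; simp [psat]

/-- For propositional formulas, modal satisfaction is propositional satisfaction. -/
theorem gsat_isProp {α W : Type} (R : W → W → Prop) (V : W → α → Prop) (w : W) (φ : MForm α) :
    φ.IsProp → (gsat R V w φ ↔ psat (V w) φ) := by
  induction φ with
  | top => intro _; simp [psat, gsat]
  | atom p => intro _; simp [psat, gsat]
  | neg φ ih => intro h; simp [psat, gsat, ih h]
  | and φ ψ ih ih' => intro h; simp [psat, gsat, ih h.1, ih' h.2]
  | box φ ih => intro h; exact h.elim

/-- Modal equivalence. -/
def Eqv {α W : Type} (R : W → W → Prop) (V : W → α → Prop) (x : W) (V' : W → α → Prop)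
    (y : W) : Prop := ∀ φ : MForm α, gsat R V x φ ↔ gsat R V' y φ

theorem Eqv.refl {α W : Type} {R : W → W → Prop} {V : W → α → Prop} {x : W} :
    Eqv R V x V x := fun _ => Iff.rfl

theorem Eqv.symm {α W : Type} {R : W → W → Prop} {V V' : W → α → Prop} {x y : W}
    (h : Eqv R V x V' y) : Eqv R V' y V x := fun φ => (h φ).symm

theorem Eqv.trans {α W : Type} {R : W → W → Prop} {V V' V'' : W → α → Prop} {x y z : W}
    (h : Eqv R V x V' y) (h' : Eqv R V' y V'' z) : Eqv R V x V'' z :=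
  fun φ => (h φ).trans (h' φ)

theorem not_eqv {α W : Type} {R : W → W → Prop} {V V' : W → α → Prop} {x y : W}
    (h : ¬ Eqv R V x V' y) : ∃ φ : MForm α, gsat R V x φ ∧ ¬ gsat R V' y φ := by
  unfold Eqv at h
  push Not at h
  obtain ⟨φ, h | h⟩ := h
  · exact ⟨φ, h⟩
  · exact ⟨.neg φ, by simpa [gsat] using h⟩

/-- Hennessy–Milner. -/
theorem Eqv.forth {α W : Type} [Fintype W] {R : W → W → Prop} {V V' : W → α → Prop} {x y x' : W}
    (h : Eqv R V x V' y) (hx : R x x') : ∃ y', R y y' ∧ Eqv R V x' V' y' := by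
  by_contra hc
  push Not at hc
  have : ∀ y', ∃ φ : MForm α, gsat R V x' φ ∧ (R y y' → ¬ gsat R V' y' φ) := by
    intro y'
    by_cases hy : R y y'
    · obtain ⟨φ, h1, h2⟩ := not_eqv (hc y' hy)
      exact ⟨φ, h1, fun _ => h2⟩
    · exact ⟨.top, by simp [gsat], fun h => absurd h hy⟩
  choose g hg1 hg2 using this
  have h1 : ¬ gsat R V x (.box (.neg (bigAnd (Finset.univ.toList.map g)))) := by
    simp only [gsat, gsat_bigAnd]
    intro H
    apply H x' hx
    intro φ hφ
    obtain ⟨y', _, rfl⟩ := List.mem_map.1 hφ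
    exact hg1 y'
  rw [h] at h1
  apply h1
  simp only [gsat, gsat_bigAnd]
  intro y' hy H
  exact hg2 y' hy (H _ (List.mem_map.2 ⟨y', by simp, rfl⟩))

theorem Eqv.back {α W : Type} [Fintype W] {R : W → W → Prop} {V V' : W → α → Prop} {x y y' : W}
    (h : Eqv R V x V' y) (hy : R y y') : ∃ x', R x x' ∧ Eqv R V x' V' y' := by
  obtain ⟨x', h1, h2⟩ := h.symm.forth hy
  exact ⟨x', h1, h2.symm⟩

theorem Eqv.reach {α W : Type} [Fintype W] {R : W → W → Prop} {V V' : W → α → Prop} {x y x' : W}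
    (h : Eqv R V x V' y) (hx : Relation.ReflTransGen R x x') :
    ∃ y', Relation.ReflTransGen R y y' ∧ Eqv R V x' V' y' := by
  induction hx with
  | refl => exact ⟨y, .refl, h⟩
  | tail _ hbc ih =>
    obtain ⟨b', h1, h2⟩ := ih
    obtain ⟨c', h3, h4⟩ := h2.forth hbc
    exact ⟨c', h1.tail h3, h4⟩

/-- Over finitely many atoms, every invariant property is definable on a finite frame. -/
theorem definable {α W : Type} [Fintype W] [Finite α] (R : W → W → Prop)
    (P : (W → α → Prop) → W → Prop)
    (hP : ∀ V x V' x', Eqv R V x V' x' → P V x → P V' x') :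
    ∃ φ : MForm α, ∀ V x, gsat R V x φ ↔ P V x := by
  classical
  have := Fintype.ofFinite α
  have : ∀ s s' : (W → α → Prop) × W, ∃ φ : MForm α, gsat R s.1 s.2 φ ∧
      (¬ Eqv R s.1 s.2 s'.1 s'.2 → ¬ gsat R s'.1 s'.2 φ) := by
    intro s s'
    by_cases h : Eqv R s.1 s.2 s'.1 s'.2
    · exact ⟨.top, by simp [gsat], fun h' => absurd h h'⟩
    · obtain ⟨φ, h1, h2⟩ := not_eqv h
      exact ⟨φ, h1, fun _ => h2⟩
  choose g hg1 hg2 using this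
  refine ⟨bigOr ((Finset.univ.filter (fun s : (W → α → Prop) × W => P s.1 s.2)).toList.map
    (fun s => bigAnd (Finset.univ.toList.map (g s)))), ?_⟩
  intro V x
  simp only [gsat_bigOr, List.mem_map, Finset.mem_toList, Finset.mem_filter, Finset.mem_univ,
    true_and, exists_exists_and_eq_and, gsat_bigAnd]
  constructor
  · rintro ⟨s, hs, H⟩
    by_cases h : Eqv R s.1 s.2 V x
    · exact hP _ _ _ _ h hs
    · exact absurd (H _ ⟨(V, x), rfl⟩) (hg2 s (V, x) h)
  · intro h
    refine ⟨(V, x), h, ?_⟩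
    rintro φ ⟨t, rfl⟩
    exact hg1 (V, x) t

theorem self_mem_subf {α : Type} [DecidableEq α] (φ : MForm α) : φ ∈ subf φ := by
  cases φ <;> simp [subf]

theorem dagSize_neg {α : Type} [DecidableEq α] (φ : MForm α) :
    (neg φ).dagSize ≤ φ.dagSize + 1 := Finset.card_insert_le _ _

theorem dagSize_and {α : Type} [DecidableEq α] (φ ψ : MForm α) :
    (MForm.and φ ψ).dagSize ≤ φ.dagSize + ψ.dagSize + 1 :=
  (Finset.card_insert_le _ _).trans (Nat.succ_le_succ (Finset.card_union_le _ _))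

theorem dagSize_imp {α : Type} [DecidableEq α] (φ ψ : MForm α) :
    (φ.imp ψ).dagSize ≤ φ.dagSize + ψ.dagSize + 3 := by
  have h1 := dagSize_neg (MForm.and φ (neg ψ))
  have h2 := dagSize_and φ (neg ψ)
  have h3 := dagSize_neg ψ
  unfold MForm.imp
  omega

theorem dagSize_bigAnd {α : Type} [DecidableEq α] (B : ℕ) (l : List (MForm α))
    (h : ∀ φ ∈ l, φ.dagSize ≤ B) : (bigAnd l).dagSize ≤ l.length * (B + 1) + 1 := by
  induction l with
  | nil => simp [bigAnd, dagSize, subf]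
  | cons a l ih =>
    have h1 := dagSize_and a (bigAnd l)
    have h2 := ih (fun φ hφ => h φ (by simp [hφ]))
    have h3 := h a (by simp)
    simp only [bigAnd, List.length_cons, Nat.add_mul]
    omega

theorem dagSize_bigOr {α : Type} [DecidableEq α] (B : ℕ) (l : List (MForm α))
    (h : ∀ φ ∈ l, φ.dagSize ≤ B) : (bigOr l).dagSize ≤ l.length * (B + 2) + 2 := by
  have h1 := dagSize_neg (bigAnd (l.map neg))
  have h2 := dagSize_bigAnd (B + 1) (l.map neg) (by
    intro φ hφ
    obtain ⟨ψ, hψ, rfl⟩ := List.mem_map.1 hφ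
    exact (dagSize_neg ψ).trans (Nat.succ_le_succ (h ψ hψ)))
  rw [List.length_map, show B + 1 + 1 = B + 2 from rfl] at h2
  unfold bigOr
  omega

theorem sig_card_le {α : Type} [DecidableEq α] (φ : MForm α) : φ.sig.card ≤ φ.dagSize := by
  have : φ.sig.image MForm.atom ⊆ φ.subf := by
    induction φ with
    | top => simp [sig]
    | atom p => simp [sig, subf]
    | neg φ ih => exact ih.trans (by simp [subf])
    | and φ ψ ih ih' =>
      simp only [sig, subf, Finset.image_union]
      exact (Finset.union_subset_union ih ih').trans (Finset.subset_insert _ _)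
    | box φ ih => exact ih.trans (by simp [subf])
  have h := Finset.card_le_card this
  rwa [Finset.card_image_of_injective _ (fun a b h => by simpa using h)] at h

theorem subf_subst {α β : Type} [DecidableEq α] [DecidableEq β] (s : α → MForm β)
    (φ : MForm α) : (substAtoms s φ).subf ⊆
      φ.subf.image (substAtoms s) ∪ φ.sig.biUnion (fun a => (s a).subf) := by
  induction φ with
  | top => simp [substAtoms, subf]
  | atom p => intro x hx; simp [substAtoms, subf, sig] at hx ⊢; exact Or.inr hx
  | neg φ ih =>
    intro x hx
    simp only [substAtoms, subf, sig, Finset.mem_insert] at hx ih ⊢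
    rcases hx with rfl | hx
    · simp [substAtoms]
    · have := ih hx
      simp only [Finset.mem_union, Finset.mem_image, Finset.mem_insert] at this ⊢
      grind
  | and φ ψ ih ih' =>
    intro x hx
    simp only [substAtoms, subf, sig, Finset.mem_insert, Finset.mem_union] at hx ⊢
    rcases hx with rfl | hx | hx
    · simp [substAtoms]
    · have := ih hx
      simp only [Finset.mem_union, Finset.mem_image, Finset.mem_insert, Finset.mem_biUnion]
        at this ⊢
      grind
    · have := ih' hx
      simp only [Finset.mem_union, Finset.mem_image, Finset.mem_insert, Finset.mem_biUnion]
        at this ⊢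
      grind
  | box φ ih =>
    intro x hx
    simp only [substAtoms, subf, sig, Finset.mem_insert] at hx ih ⊢
    rcases hx with rfl | hx
    · simp [substAtoms]
    · have := ih hx
      simp only [Finset.mem_union, Finset.mem_image, Finset.mem_insert] at this ⊢
      grind

theorem dagSize_subst {α β : Type} [DecidableEq α] [DecidableEq β] (s : α → MForm β) (C : ℕ)
    (hs : ∀ a, (s a).dagSize ≤ C) (φ : MForm α) :
    (substAtoms s φ).dagSize ≤ φ.dagSize * (C + 1) := by
  have h1 := Finset.card_le_card (subf_subst s φ)
  have h2 := Finset.card_union_le (φ.subf.image (substAtoms s))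
    (φ.sig.biUnion (fun a => (s a).subf))
  have h3 : (φ.subf.image (substAtoms s)).card ≤ φ.dagSize := Finset.card_image_le
  have h4 : (φ.sig.biUnion (fun a => (s a).subf)).card ≤ φ.sig.card * C :=
    Finset.card_biUnion_le_card_mul _ _ _ (fun a _ => hs a)
  have h5 := Nat.mul_le_mul_right C (sig_card_le φ)
  have h6 : (substAtoms s φ).dagSize = (substAtoms s φ).subf.card := rfl
  rw [Nat.mul_succ]
  omega

theorem sig_subst {α β : Type} [DecidableEq α] [DecidableEq β] (s : α → MForm β) (σ : Finset β)
    (hs : ∀ a, (s a).sig ⊆ σ) (φ : MForm α) : (substAtoms s φ).sig ⊆ σ := by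
  induction φ with
  | top => simp [substAtoms, sig]
  | atom p => exact hs p
  | neg φ ih => exact ih
  | and φ ψ ih ih' => exact Finset.union_subset ih ih'
  | box φ ih => exact ih

theorem sig_bigAnd {β : Type} [DecidableEq β] (l : List (MForm β)) (a : β) :
    a ∈ (bigAnd l).sig ↔ ∃ φ ∈ l, a ∈ φ.sig := by
  induction l with
  | nil => simp [bigAnd, sig]
  | cons b l ih => simp [bigAnd, sig, ih]

theorem sig_bigOr {β : Type} [DecidableEq β] (l : List (MForm β)) (a : β) :
    a ∈ (bigOr l).sig ↔ ∃ φ ∈ l, a ∈ φ.sig := by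
  simp [bigOr, sig, sig_bigAnd]

theorem isProp_bigAnd {β : Type} (l : List (MForm β)) (h : ∀ φ ∈ l, φ.IsProp) :
    (bigAnd l).IsProp := by
  induction l with
  | nil => simp [bigAnd, IsProp]
  | cons b l ih => exact ⟨h b (by simp), ih fun φ hφ => h φ (by simp [hφ])⟩

open Classical in
/-- The successors of a world. -/
noncomputable def succs {W : Type} [Fintype W] (R : W → W → Prop) (w : W) : List W :=
  (Finset.univ.filter (R w)).toList

theorem mem_succs {W : Type} [Fintype W] (R : W → W → Prop) (w v : W) :
    v ∈ succs R w ↔ R w v := by simp [succs]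

/-- Propositional translation of a modal formula at a world. -/
noncomputable def tr {W : Type} [Fintype W] (R : W → W → Prop) (e : W → ℕ → ℕ) :
    MForm ℕ → W → MForm ℕ
  | .top, _ => .top
  | .atom p, w => .atom (e w p)
  | .neg φ, w => .neg (tr R e φ w)
  | .and φ ψ, w => .and (tr R e φ w) (tr R e ψ w)
  | .box φ, w => bigAnd ((succs R w).map (tr R e φ))

theorem psat_tr {W : Type} [Fintype W] (R : W → W → Prop) (e : W → ℕ → ℕ) (v : ℕ → Prop)
    (φ : MForm ℕ) : ∀ w, psat v (tr R e φ w) ↔ gsat R (fun w p => v (e w p)) w φ := by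
  induction φ with
  | top => intro w; simp [tr, psat, gsat]
  | atom p => intro w; simp [tr, psat, gsat]
  | neg φ ih => intro w; simp [tr, psat, gsat, ih]
  | and φ ψ ih ih' => intro w; simp [tr, psat, gsat, ih, ih']
  | box φ ih => intro w; simp [tr, gsat, psat_bigAnd, mem_succs, ih]

theorem isProp_tr {W : Type} [Fintype W] (R : W → W → Prop) (e : W → ℕ → ℕ)
    (φ : MForm ℕ) : ∀ w, (tr R e φ w).IsProp := by
  induction φ with
  | top => intro w; simp [tr, IsProp]
  | atom p => intro w; simp [tr, IsProp]
  | neg φ ih => intro w; simp [tr, IsProp, ih]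
  | and φ ψ ih ih' => intro w; simp [tr, IsProp, ih, ih']
  | box φ ih =>
    intro w
    apply isProp_bigAnd
    intro φ hφ
    obtain ⟨v, _, rfl⟩ := List.mem_map.1 hφ
    exact ih v

theorem sig_tr {W : Type} [Fintype W] (R : W → W → Prop) (e : W → ℕ → ℕ)
    (φ : MForm ℕ) (a : ℕ) : ∀ w, a ∈ (tr R e φ w).sig → ∃ x, ∃ p ∈ φ.sig, a = e x p := by
  induction φ with
  | top => intro w; simp [tr, sig]
  | atom p => intro w; simp only [tr, sig, Finset.mem_singleton]; rintro rfl; exact ⟨w, p, rfl, rfl⟩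
  | neg φ ih => intro w; exact ih w
  | and φ ψ ih ih' =>
    intro w h
    simp only [tr, sig, Finset.mem_union] at h ⊢
    rcases h with h | h
    · obtain ⟨x, p, hp, rfl⟩ := ih w h
      exact ⟨x, p, Or.inl hp, rfl⟩
    · obtain ⟨x, p, hp, rfl⟩ := ih' w h
      exact ⟨x, p, Or.inr hp, rfl⟩
  | box φ ih =>
    intro w h
    simp only [tr, sig_bigAnd, List.mem_map] at h
    obtain ⟨_, ⟨v, _, rfl⟩, h⟩ := h
    exact ih v h

theorem subf_bigAnd {β : Type} [DecidableEq β] (l : List (MForm β)) :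
    (bigAnd l).subf ⊆ (l.tails.map bigAnd).toFinset ∪ l.toFinset.biUnion subf := by
  induction l with
  | nil => simp [bigAnd, subf]
  | cons b l ih =>
    intro x hx
    simp only [bigAnd, subf, Finset.mem_insert, Finset.mem_union] at hx
    rcases hx with rfl | hx | hx
    · simp [bigAnd]
    · simp [hx]
    · have := ih hx
      simp only [Finset.mem_union, List.mem_toFinset, List.mem_map, List.mem_tails,
        Finset.mem_biUnion] at this ⊢
      rcases this with ⟨t, ht, rfl⟩ | ⟨c, hc, hx⟩
      · exact Or.inl ⟨t, ht.trans (List.suffix_cons _ _), rfl⟩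
      · exact Or.inr ⟨c, by simp [hc], hx⟩

/-- The subformulas contributed by one subformula to the translation. -/
noncomputable def contrib {W : Type} [Fintype W] (R : W → W → Prop) (e : W → ℕ → ℕ)
    (φ : MForm ℕ) : Finset (MForm ℕ) :=
  Finset.univ.biUnion (fun w : W => insert (tr R e φ w) (match φ with
    | .box ψ => (((succs R w).map (tr R e ψ)).tails.map bigAnd).toFinset
    | _ => ∅))

theorem contrib_card {W : Type} [Fintype W] (R : W → W → Prop) (e : W → ℕ → ℕ)
    (φ : MForm ℕ) : (contrib R e φ).card ≤ Fintype.card W * (Fintype.card W + 2) := by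
  apply Finset.card_biUnion_le_card_mul
  intro w _
  refine (Finset.card_insert_le _ _).trans (Nat.succ_le_succ ?_)
  split
  · refine (List.toFinset_card_le _).trans ?_
    simp only [List.length_map, List.length_tails]
    apply Nat.succ_le_succ
    simp only [succs, Finset.length_toList]
    exact Finset.card_le_univ _
  · simp

theorem tr_mem_contrib {W : Type} [Fintype W] (R : W → W → Prop) (e : W → ℕ → ℕ)
    (φ : MForm ℕ) (w : W) : tr R e φ w ∈ contrib R e φ :=
  Finset.mem_biUnion.2 ⟨w, Finset.mem_univ _, Finset.mem_insert_self _ _⟩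

theorem subf_tr {W : Type} [Fintype W] (R : W → W → Prop) (e : W → ℕ → ℕ)
    (φ : MForm ℕ) : ∀ w, (tr R e φ w).subf ⊆ φ.subf.biUnion (contrib R e) := by
  have key : ∀ (ψ φ : MForm ℕ), ψ.subf ⊆ φ.subf →
      ψ.subf.biUnion (contrib R e) ⊆ φ.subf.biUnion (contrib R e) :=
    fun ψ φ h => Finset.biUnion_subset_biUnion_of_subset_left _ h
  have self : ∀ φ w, tr R e φ w ∈ φ.subf.biUnion (contrib R e) := fun φ w =>
    Finset.mem_biUnion.2 ⟨φ, self_mem_subf φ, tr_mem_contrib R e φ w⟩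
  induction φ with
  | top => intro w x hx; simp only [tr, subf, Finset.mem_singleton] at hx; subst hx; exact self _ w
  | atom p =>
    intro w x hx; simp only [tr, subf, Finset.mem_singleton] at hx; subst hx; exact self _ w
  | neg φ ih =>
    intro w x hx
    rw [tr, subf, Finset.mem_insert] at hx
    rcases hx with rfl | hx
    · exact self (.neg φ) w
    · exact key φ _ (by simp [subf]) (ih w hx)
  | and φ ψ ih ih' =>
    intro w x hx
    rw [tr, subf, Finset.mem_insert, Finset.mem_union] at hx
    rcases hx with rfl | hx | hx
    · exact self (.and φ ψ) w
    · exact key φ _ (fun y hy => by simp [subf, hy]) (ih w hx)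
    · exact key ψ _ (fun y hy => by simp [subf, hy]) (ih' w hx)
  | box φ ih =>
    intro w x hx
    have := subf_bigAnd _ hx
    rw [Finset.mem_union, Finset.mem_biUnion] at this
    rcases this with h | ⟨c, hc, h⟩
    · refine Finset.mem_biUnion.2 ⟨.box φ, self_mem_subf _, ?_⟩
      exact Finset.mem_biUnion.2 ⟨w, Finset.mem_univ _, Finset.mem_insert_of_mem h⟩
    · rw [List.mem_toFinset] at hc
      obtain ⟨v, _, rfl⟩ := List.mem_map.1 hc
      exact key φ _ (by simp [subf]) (ih v h)

theorem dagSize_tr {W : Type} [Fintype W] (R : W → W → Prop) (e : W → ℕ → ℕ)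
    (φ : MForm ℕ) (w : W) :
    (tr R e φ w).dagSize ≤ φ.dagSize * (Fintype.card W * (Fintype.card W + 2)) :=
  (Finset.card_le_card (subf_tr R e φ w)).trans
    (Finset.card_biUnion_le_card_mul _ _ _ (fun ψ _ => contrib_card R e ψ))

/-- Lower bound for propositional interpolant size. -/
theorem f_large (f : ℕ → ℕ) (hf : ∀ χ₁ χ₂ : MForm ℕ, χ₁.IsProp → χ₂.IsProp → PTaut (χ₁.imp χ₂) →
        ∃ ξ : MForm ℕ, PCraig χ₁ χ₂ ξ ∧ ξ.dagSize ≤ f (χ₁.imp χ₂).dagSize)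
    (hm : Monotone f) (k : ℕ) : k ≤ f (4 * k + 5) := by
  set χ : MForm ℕ := bigAnd ((List.range k).map MForm.atom) with hχ
  have hs : χ.dagSize ≤ 2 * k + 1 := by
    have := dagSize_bigAnd 1 ((List.range k).map (MForm.atom (α := ℕ))) (by
      intro φ hφ
      obtain ⟨p, _, rfl⟩ := List.mem_map.1 hφ
      simp [dagSize, subf])
    rw [← hχ] at this
    simp only [List.length_map, List.length_range] at this
    omega
  have hp : χ.IsProp := isProp_bigAnd _ (by
      intro φ hφ
      obtain ⟨p, _, rfl⟩ := List.mem_map.1 hφ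
      simp [IsProp])
  have hsat : ∀ v, psat v χ ↔ ∀ p < k, v p := by
    intro v
    simp [hχ, psat_bigAnd, psat]
  obtain ⟨ξ, ⟨_, _, h1, h2⟩, h3⟩ := hf χ χ hp hp (fun v => by simp [psat_imp])
  have hk : Finset.range k ⊆ ξ.sig := by
    intro p hpk
    by_contra hn
    have a1 : psat (fun _ => True) ξ := (psat_imp _ _ _).1 (h1 _) ((hsat _).2 (by simp))
    have a2 : psat (fun q => q ≠ p) ξ := by
      refine (psat_congr _ _ ξ ?_).1 a1
      intro a ha
      have : a ≠ p := by rintro rfl; exact hn ha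
      simp [this]
    have a3 := (hsat _).1 ((psat_imp _ _ _).1 (h2 _) a2) p (by simpa using hpk)
    exact a3 rfl
  have h4 := Finset.card_le_card hk
  rw [Finset.card_range] at h4
  have h5 := sig_card_le ξ
  have h6 := dagSize_imp χ χ
  exact (h4.trans (h5.trans h3)).trans (hm (by omega))

theorem red_eqv {K W : Type} {R : W → W → Prop} {V V' : W → Option K → Prop} {x x' : W}
    (h : Eqv R V x V' x') :
    Eqv R (fun x k => V x (some k)) x (fun x k => V' x (some k)) x' := by
  intro φ
  have := h (substAtoms (fun k => MForm.atom (some k)) φ)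
  rwa [gsat_subst, gsat_subst] at this

theorem exists_D {K W : Type} [Fintype W] [Finite K] (R : W → W → Prop)
    (V0 : W → K → Prop) (w : W) : ∃ D : MForm K, ∀ V y, gsat R V y D ↔ Eqv R V0 w V y :=
  definable R (fun V y => Eqv R V0 w V y) (fun _ _ _ _ h h' => h'.trans h)

theorem exists_theta {K W : Type} [Fintype W] [Finite K] (R : W → W → Prop)
    (V0 : W → K → Prop) (w : W) : ∃ θ : MForm (Option K), ∀ V y, gsat R V y θ ↔
      ∃ x, Relation.ReflTransGen R y x ∧ Eqv R V0 w (fun x k => V x (some k)) x ∧ V x none := by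
  apply definable R
  rintro V x V' x' h ⟨y, h1, h2, h3⟩
  obtain ⟨y', h4, h5⟩ := h.reach h1
  exact ⟨y', h4, h2.trans (red_eqv h5), (h5 (.atom none)).1 h3⟩

theorem exists_gamma {K W : Type} [Fintype W] [Finite K] (R : W → W → Prop) :
    ∃ γ : MForm (Option K), ∀ V y, gsat R V y γ ↔
      ∀ x x', Relation.ReflTransGen R y x → Relation.ReflTransGen R y x' →
        Eqv R (fun x k => V x (some k)) x (fun x k => V x (some k)) x' →
        (V x none ↔ V x' none) := by
  apply definable R
  intro V y V' y' h H x x' hx hx' he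
  obtain ⟨z, h1, h2⟩ := h.symm.reach hx
  obtain ⟨z', h1', h2'⟩ := h.symm.reach hx'
  have := H z z' h1 h1' (((red_eqv h2).symm.trans he).trans (red_eqv h2'))
  exact ((h2 (.atom none)).trans this).trans (h2' (.atom none)).symm

theorem exists_rep {K W : Type} (R : W → W → Prop) (V0 : W → K → Prop) :
    ∃ rep : W → W, (∀ w, Eqv R V0 w V0 (rep w)) ∧
      ∀ w w', Eqv R V0 w V0 w' → rep w = rep w' := by
  let S : Setoid W := ⟨fun x y => Eqv R V0 x V0 y, fun _ => Eqv.refl, fun h => h.symm,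
    fun h h' => h.trans h'⟩
  refine ⟨fun w => (Quotient.mk S w).out, fun w => ?_, fun w w' h => ?_⟩
  · exact (Quotient.exact (s := S) (Quotient.out_eq (Quotient.mk S w))).symm
  · have : Quotient.mk S w = Quotient.mk S w' := Quotient.sound (s := S) h
    simp only [this]

theorem exists_code (W : Type) [Fintype W] : ∃ c : Fin 3 → ℕ → W → ℕ,
    ∀ a p w b q x, c a p w = c b q x ↔ (a = b ∧ p = q ∧ w = x) := by
  have : Countable (Fin 3 × ℕ × W) := inferInstance
  obtain ⟨g, hg⟩ := exists_injective_nat (Fin 3 × ℕ × W)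
  refine ⟨fun a p w => g (a, p, w), ?_⟩
  intro a p w b q x
  rw [hg.eq_iff]
  simp

/-- Atom coding. -/
def en {W : Type} (c : Fin 3 → ℕ → W → ℕ) (σ : Finset ℕ) (n : Fin 3) (z : W → W) (w : W)
    (p : ℕ) : ℕ := if p ∈ σ then c 0 p (z w) else c n p w

/-- Valuation of the coded atoms. -/
def val {W : Type} (c : Fin 3 → ℕ → W → ℕ) (Θ : ℕ → W → Prop) (V : W → ℕ → Prop) (a : ℕ) : Prop :=
  ∃ p w, (a = c 0 p w ∧ Θ p w) ∨ ((a = c 1 p w ∨ a = c 2 p w) ∧ V w p)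

theorem val_zero {W : Type} {c : Fin 3 → ℕ → W → ℕ}
    (hc : ∀ a p w b q x, c a p w = c b q x ↔ (a = b ∧ p = q ∧ w = x))
    (Θ : ℕ → W → Prop) (V : W → ℕ → Prop) (p : ℕ) (w : W) : val c Θ V (c 0 p w) ↔ Θ p w := by
  simp [val, hc]

theorem val_ne {W : Type} {c : Fin 3 → ℕ → W → ℕ}
    (hc : ∀ a p w b q x, c a p w = c b q x ↔ (a = b ∧ p = q ∧ w = x))
    (Θ : ℕ → W → Prop) (V : W → ℕ → Prop) (n : Fin 3) (hn : n ≠ 0) (p : ℕ) (w : W) :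
    val c Θ V (c n p w) ↔ V w p := by
  have : n = 1 ∨ n = 2 := by omega
  rcases this with rfl | rfl <;> simp [val, hc]

theorem tr_val {W : Type} [Fintype W] {c : Fin 3 → ℕ → W → ℕ}
    (hc : ∀ a p w b q x, c a p w = c b q x ↔ (a = b ∧ p = q ∧ w = x))
    (R : W → W → Prop) (σ : Finset ℕ)
    (Θ : ℕ → W → Prop) (V : W → ℕ → Prop) (n : Fin 3) (hn : n ≠ 0) (z : W → W) (j : W)
    (h : ∀ x, Relation.ReflTransGen R j x → ∀ p ∈ σ, (Θ p (z x) ↔ V x p)) (φ : MForm ℕ) :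
    psat (val c Θ V) (tr R (en c σ n z) φ j) ↔ gsat R V j φ := by
  rw [psat_tr]
  refine bisim R R _ _ (fun x y => x = y ∧ Relation.ReflTransGen R j x) ?_ ?_ φ ?_ j j
    ⟨rfl, .refl⟩
  · rintro x _ x' ⟨rfl, h⟩ hr
    exact ⟨x', hr, rfl, h.tail hr⟩
  · rintro x _ x' ⟨rfl, h⟩ hr
    exact ⟨x', hr, rfl, h.tail hr⟩
  · rintro x _ ⟨rfl, hx⟩ p _
    by_cases hp : p ∈ σ
    · simp only [en, hp, if_true, val_zero hc]
      exact h x hx p hp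
    · simp only [en, hp, if_false, val_ne hc Θ V n hn]

/-- Goodness of a map between worlds. -/
def Good {W : Type} (R : W → W → Prop) (r z : W → W) (i j : W) : Prop :=
  ∀ (u : W → ℕ → Prop) (φ : MForm ℕ),
    gsat R (fun w p => u (r w) p) i φ ↔ gsat R (fun w p => u (z w) p) j φ

open Classical in
/-- The right-hand side of the propositional implication. -/
noncomputable def rhs {ι W : Type} [Fintype ι] [Fintype W] (R : W → W → Prop) (pt : ι → W)
    (c : Fin 3 → ℕ → W → ℕ) (σ : Finset ℕ) (ψ : MForm ℕ) (r : W → W) (i : ι) : MForm ℕ :=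
  bigAnd ((Finset.univ.filter (fun jz : ι × (W → W) => Good R r jz.2 (pt i) (pt jz.1))).toList.map
    (fun jz => tr R (en c σ 2 jz.2) ψ (pt jz.1)))

theorem rhs_isProp {ι W : Type} [Fintype ι] [Fintype W] (R : W → W → Prop) (pt : ι → W)
    (c : Fin 3 → ℕ → W → ℕ) (σ : Finset ℕ) (ψ : MForm ℕ) (r : W → W) (i : ι) :
    (rhs R pt c σ ψ r i).IsProp := by
  apply isProp_bigAnd
  intro φ hφ
  obtain ⟨jz, _, rfl⟩ := List.mem_map.1 hφ
  exact isProp_tr _ _ _ _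

theorem psat_rhs {ι W : Type} [Fintype ι] [Fintype W] (R : W → W → Prop) (pt : ι → W)
    (c : Fin 3 → ℕ → W → ℕ) (σ : Finset ℕ) (ψ : MForm ℕ) (r : W → W) (i : ι) (v : ℕ → Prop) :
    psat v (rhs R pt c σ ψ r i) ↔ ∀ j z, Good R r z (pt i) (pt j) →
      psat v (tr R (en c σ 2 z) ψ (pt j)) := by
  simp [rhs, psat_bigAnd]
  grind

theorem rhs_size {ι W : Type} [Fintype ι] [Fintype W] [DecidableEq W]
    (R : W → W → Prop) (pt : ι → W)
    (c : Fin 3 → ℕ → W → ℕ) (σ : Finset ℕ) (ψ : MForm ℕ) (r : W → W) (i : ι) :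
    (rhs R pt c σ ψ r i).dagSize ≤ Fintype.card (ι × (W → W)) *
      (ψ.dagSize * (Fintype.card W * (Fintype.card W + 2)) + 1) + 1 := by
  refine (dagSize_bigAnd (ψ.dagSize * (Fintype.card W * (Fintype.card W + 2))) _ ?_).trans ?_
  · intro φ hφ
    obtain ⟨jz, _, rfl⟩ := List.mem_map.1 hφ
    exact dagSize_tr _ _ _ _
  · rw [List.length_map, Finset.length_toList]
    refine Nat.succ_le_succ (Nat.mul_le_mul_right _ ?_)
    refine (Finset.card_le_univ _).trans (le_of_eq ?_)
    exact Fintype.card_congr (Equiv.refl _)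

theorem rhs_sig {ι W : Type} [Fintype ι] [Fintype W] (R : W → W → Prop) (pt : ι → W)
    {c : Fin 3 → ℕ → W → ℕ}
    (hc : ∀ a p w b q x, c a p w = c b q x ↔ (a = b ∧ p = q ∧ w = x))
    (φ ψ : MForm ℕ) (r : W → W) (i : ι) (a : ℕ)
    (h1 : a ∈ (tr R (en c (φ.sig ∩ ψ.sig) 1 r) φ (pt i)).sig)
    (h2 : a ∈ (rhs R pt c (φ.sig ∩ ψ.sig) ψ r i).sig) :
    ∃ p w, p ∈ φ.sig ∩ ψ.sig ∧ a = c 0 p w := by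
  obtain ⟨x, p, hp, rfl⟩ := sig_tr _ _ _ _ _ h1
  by_cases hps : p ∈ φ.sig ∩ ψ.sig
  · exact ⟨p, r x, hps, by simp only [en, hps, if_true]⟩
  · exfalso
    simp only [rhs, sig_bigAnd, List.mem_map] at h2
    obtain ⟨_, ⟨jz, _, rfl⟩, h2⟩ := h2
    obtain ⟨y, q, hq, he⟩ := sig_tr _ _ _ _ _ h2
    simp only [en, hps, if_false] at he
    split at he <;> simp [hc] at he

/-- The propositional implication is a tautology, given a modal interpolant. -/
theorem rhs_taut {ι W : Type} [Fintype ι] [Fintype W] (R : W → W → Prop) (pt : ι → W)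
    {c : Fin 3 → ℕ → W → ℕ} (σ : Finset ℕ) (φ ψ χ : MForm ℕ) (r : W → W) (i : ι)
    (hχ : χ.sig ⊆ σ)
    (h1 : ∀ i V, gsat R V (pt i) φ → gsat R V (pt i) χ)
    (h2 : ∀ i V, gsat R V (pt i) χ → gsat R V (pt i) ψ) :
    PTaut ((tr R (en c σ 1 r) φ (pt i)).imp (rhs R pt c σ ψ r i)) := by
  intro v
  rw [psat_imp, psat_rhs]
  intro h j z hz
  rw [psat_tr] at h ⊢
  apply h2
  have h := h1 _ _ h
  have key : ∀ (n : Fin 3) (z : W → W) (k : W),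
      gsat R (fun w p => v (en c σ n z w p)) k χ ↔ gsat R (fun w p => v (c 0 p (z w))) k χ := by
    intro n z k
    refine bisim R R _ _ (fun x y => x = y) ?_ ?_ χ ?_ k k rfl
    · rintro x _ x' rfl hr; exact ⟨x', hr, rfl⟩
    · rintro x _ x' rfl hr; exact ⟨x', hr, rfl⟩
    · rintro x _ rfl p hp
      simp only [en, hχ hp, if_true]
  rw [key] at h ⊢
  exact (hz (fun w p => v (c 0 p w)) χ).1 h

theorem exists_subst {K W : Type} {c : Fin 3 → ℕ → W → ℕ}
    (hc : ∀ a p w b q x, c a p w = c b q x ↔ (a = b ∧ p = q ∧ w = x)) (σ : Finset ℕ)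
    (θ : W → MForm (Option K)) (τ : K → MForm ℕ) :
    ∃ s : ℕ → MForm ℕ,
      (∀ p w, p ∈ σ → s (c 0 p w) = substAtoms (fun o => o.elim (MForm.atom p) τ) (θ w)) ∧
      ∀ a, s a = .top ∨ ∃ p ∈ σ, ∃ w, s a = substAtoms (fun o => o.elim (MForm.atom p) τ) (θ w) := by
  classical
  refine ⟨fun a => if h : ∃ pw : ℕ × W, pw.1 ∈ σ ∧ a = c 0 pw.1 pw.2 then
    substAtoms (fun o => o.elim (MForm.atom h.choose.1) τ) (θ h.choose.2) else .top, ?_, ?_⟩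
  · intro p w hp
    have h : ∃ pw : ℕ × W, pw.1 ∈ σ ∧ c 0 p w = c 0 pw.1 pw.2 := ⟨(p, w), hp, rfl⟩
    have hs := h.choose_spec.2
    rw [hc] at hs
    simp only [dif_pos h]
    rw [← hs.2.1, ← hs.2.2]
  · intro a
    by_cases h : ∃ pw : ℕ × W, pw.1 ∈ σ ∧ a = c 0 pw.1 pw.2
    · right
      exact ⟨h.choose.1, h.choose_spec.1, h.choose.2, by simp only [dif_pos h]⟩
    · left
      simp only [dif_neg h]

/-- The finitely many separating tuples. -/
def taus (K : Type) [Fintype K] [DecidableEq K] (σ : Finset ℕ) : Finset (K → MForm ℕ) :=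
  Fintype.piFinset (fun _ : K => insert .top (σ.image MForm.atom))

theorem taus_card (K : Type) [Fintype K] [DecidableEq K] (σ : Finset ℕ) :
    (taus K σ).card ≤ (σ.card + 1) ^ Fintype.card K := by
  rw [taus, Fintype.card_piFinset, Finset.prod_const, Finset.card_univ]
  exact Nat.pow_le_pow_left ((Finset.card_insert_le _ _).trans
    (Nat.succ_le_succ Finset.card_image_le)) _

theorem taus_size {K : Type} [Fintype K] [DecidableEq K] {σ : Finset ℕ} {τ : K → MForm ℕ}
    (h : τ ∈ taus K σ) (k : K) : (τ k).dagSize ≤ 1 ∧ (τ k).sig ⊆ σ := by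
  have := Fintype.mem_piFinset.1 h k
  simp only [Finset.mem_insert, Finset.mem_image] at this
  rcases this with h | ⟨p, hp, h⟩
  · rw [h]; simp [dagSize, subf, sig]
  · rw [← h]; simp [dagSize, subf, sig, hp]

theorem core {ι W : Type} [Fintype ι] [Fintype W] (R : W → W → Prop) (pt : ι → W) :
    ∃ p q : Polynomial ℕ, ∀ f : ℕ → ℕ, Monotone f →
      (∀ χ₁ χ₂ : MForm ℕ, χ₁.IsProp → χ₂.IsProp → PTaut (χ₁.imp χ₂) →
        ∃ ξ : MForm ℕ, PCraig χ₁ χ₂ ξ ∧ ξ.dagSize ≤ f (χ₁.imp χ₂).dagSize) →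
      ∀ φ ψ χ₀ : MForm ℕ, χ₀.sig ⊆ φ.sig ∩ ψ.sig →
        (∀ i V, gsat R V (pt i) φ → gsat R V (pt i) χ₀) →
        (∀ i V, gsat R V (pt i) χ₀ → gsat R V (pt i) ψ) →
        ∃ χ : MForm ℕ, χ.sig ⊆ φ.sig ∩ ψ.sig ∧
          (∀ i V, gsat R V (pt i) φ → gsat R V (pt i) χ) ∧
          (∀ i V, gsat R V (pt i) χ → gsat R V (pt i) ψ) ∧
          χ.dagSize ≤ p.eval (f (q.eval (φ.dagSize + ψ.dagSize))) := by
  classical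
  let K := W × W
  choose D hD using fun (V0 : W → K → Prop) (w : W) => exists_D R V0 w
  choose θ hθ using fun (V0 : W → K → Prop) (w : W) => exists_theta R V0 w
  obtain ⟨γ, hγ⟩ := exists_gamma (K := K) R
  choose rep hrep1 hrep2 using fun (V0 : W → K → Prop) => exists_rep R V0
  obtain ⟨c, hc⟩ := exists_code W
  obtain ⟨C, hCD, hCθ, hCγ⟩ : ∃ C : ℕ, (∀ V0 w, (D V0 w).dagSize ≤ C) ∧
      (∀ V0 w, (θ V0 w).dagSize ≤ C) ∧ γ.dagSize ≤ C := by
    obtain ⟨C1, h1⟩ := Finite.exists_le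
      (fun x : (W → K → Prop) × W => (D x.1 x.2).dagSize)
    obtain ⟨C2, h2⟩ := Finite.exists_le
      (fun x : (W → K → Prop) × W => (θ x.1 x.2).dagSize)
    refine ⟨C1 + C2 + γ.dagSize, fun V0 w => ?_, fun V0 w => ?_, by omega⟩
    · have := h1 (V0, w); simp only at this; omega
    · have := h2 (V0, w); simp only at this; omega
  let G := Fintype.card W * (Fintype.card W + 2)
  let Z := Fintype.card (ι × (W → W))
  let A := Fintype.card ι * Fintype.card (W → K → Prop)
  refine ⟨Polynomial.C A * (Polynomial.X + 1) ^ Fintype.card K *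
      (Polynomial.C (4 * C + 4) * (Polynomial.X + 1) + 2) + 2,
    Polynomial.X * Polynomial.C G + Polynomial.C Z * (Polynomial.X * Polynomial.C G + 1) +
      Polynomial.C 4 * Polynomial.X + 9, ?_⟩
  intro f hf hint φ ψ χ₀ hχ₀ hφχ hχψ
  set σ := φ.sig ∩ ψ.sig with hσ
  simp only [Polynomial.eval_add, Polynomial.eval_mul, Polynomial.eval_pow, Polynomial.eval_C,
    Polynomial.eval_X, Polynomial.eval_one, Polynomial.eval_ofNat]
  set n := φ.dagSize + ψ.dagSize with hn
  set m := f (n * G + Z * (n * G + 1) + 4 * n + 9) with hm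
  have hnm : n ≤ m := (f_large f hint hf n).trans (hf (by
    have := Nat.zero_le (n * G + Z * (n * G + 1)); omega))
  have hξ : ∀ (V0 : W → K → Prop) (i : ι), ∃ ξ : MForm ℕ,
      PCraig (tr R (en c σ 1 (rep V0)) φ (pt i)) (rhs R pt c σ ψ (rep V0) i) ξ ∧
        ξ.dagSize ≤ m := by
    intro V0 i
    obtain ⟨ξ, h1, h2⟩ := hint _ _ (isProp_tr R (en c σ 1 (rep V0)) φ (pt i))
      (rhs_isProp R pt c σ ψ (rep V0) i)
      (rhs_taut R pt σ φ ψ χ₀ (rep V0) i hχ₀ hφχ hχψ)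
    refine ⟨ξ, h1, h2.trans (hf ?_)⟩
    refine (dagSize_imp _ _).trans ?_
    have a1 := dagSize_tr R (en c σ 1 (rep V0)) φ (pt i)
    have a2 := rhs_size R pt c σ ψ (rep V0) i
    have a3 : φ.dagSize * G ≤ n * G := Nat.mul_le_mul_right _ (by omega)
    have a4 : Z * (ψ.dagSize * G + 1) ≤ Z * (n * G + 1) :=
      Nat.mul_le_mul_left _ (Nat.succ_le_succ (Nat.mul_le_mul_right _ (by omega)))
    have a5 : (tr R (en c σ 1 (rep V0)) φ (pt i)).dagSize ≤ φ.dagSize * G := a1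
    have a6 : (rhs R pt c σ ψ (rep V0) i).dagSize ≤ Z * (ψ.dagSize * G + 1) + 1 := by
      convert a2
    omega
  choose ξ hξ1 hξ2 using hξ
  choose s hs1 hs2 using fun (V0 : W → K → Prop) (τ : K → MForm ℕ) =>
    exists_subst hc σ (θ V0) τ
  let disj : ι × (W → K → Prop) × (K → MForm ℕ) → MForm ℕ := fun t =>
    .and (substAtoms t.2.2 (D t.2.1 (pt t.1)))
      (.and (bigAnd (σ.toList.map (fun p =>
          substAtoms (fun o : Option K => o.elim (MForm.atom p) t.2.2) γ)))
        (substAtoms (s t.2.1 t.2.2) (ξ t.2.1 t.1)))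
  let idx : Finset (ι × (W → K → Prop) × (K → MForm ℕ)) :=
    Finset.univ ×ˢ (Finset.univ ×ˢ taus K σ)
  have hidx : ∀ t, t ∈ idx ↔ t.2.2 ∈ taus K σ := fun t => by simp [idx]
  -- semantics of the substituted templates
  have semθ : ∀ (V : W → ℕ → Prop) y V0 (τ : K → MForm ℕ) p w,
      gsat R V y (substAtoms (fun o : Option K => o.elim (MForm.atom p) τ) (θ V0 w)) ↔
      ∃ x, Relation.ReflTransGen R y x ∧ Eqv R V0 w (fun x k => gsat R V x (τ k)) x ∧ V x p := by
    intro V y V0 τ p w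
    rw [gsat_subst, hθ]
    rfl
  have semγ : ∀ (V : W → ℕ → Prop) y (τ : K → MForm ℕ) p,
      gsat R V y (substAtoms (fun o : Option K => o.elim (MForm.atom p) τ) γ) ↔
      ∀ x x', Relation.ReflTransGen R y x → Relation.ReflTransGen R y x' →
        Eqv R (fun x k => gsat R V x (τ k)) x (fun x k => gsat R V x (τ k)) x' →
        (V x p ↔ V x' p) := by
    intro V y τ p
    rw [gsat_subst, hγ]
    rfl
  have semD : ∀ (V : W → ℕ → Prop) y V0 (τ : K → MForm ℕ) w,
      gsat R V y (substAtoms τ (D V0 w)) ↔ Eqv R V0 w (fun x k => gsat R V x (τ k)) y := by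
    intro V y V0 τ w
    rw [gsat_subst, hD]
  have semξ : ∀ (V : W → ℕ → Prop) y V0 (τ : K → MForm ℕ) i,
      gsat R V y (substAtoms (s V0 τ) (ξ V0 i)) ↔
      psat (val c (fun p w => ∃ x, Relation.ReflTransGen R y x ∧
        Eqv R V0 w (fun x k => gsat R V x (τ k)) x ∧ V x p) V) (ξ V0 i) := by
    intro V y V0 τ i
    rw [gsat_subst, gsat_isProp _ _ _ _ (hξ1 V0 i).1]
    apply psat_congr
    intro a ha
    have ha' := Finset.mem_inter.1 ((hξ1 V0 i).2.1 ha)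
    obtain ⟨p, w, hp, rfl⟩ := rhs_sig R pt hc φ ψ (rep V0) i a ha'.1 ha'.2
    rw [val_zero hc, hs1 _ _ _ _ hp, semθ]
  have semdisj : ∀ (V : W → ℕ → Prop) y t, gsat R V y (disj t) ↔
      gsat R V y (substAtoms t.2.2 (D t.2.1 (pt t.1))) ∧
      (∀ p ∈ σ, gsat R V y (substAtoms (fun o : Option K => o.elim (MForm.atom p) t.2.2) γ)) ∧
      gsat R V y (substAtoms (s t.2.1 t.2.2) (ξ t.2.1 t.1)) := by
    intro V y t
    simp [disj, gsat, gsat_bigAnd]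
  have keyΘ : ∀ (V : W → ℕ → Prop) y V0 (τ : K → MForm ℕ) (z : W → W),
      (∀ p ∈ σ, ∀ x x', Relation.ReflTransGen R y x → Relation.ReflTransGen R y x' →
        Eqv R (fun x k => gsat R V x (τ k)) x (fun x k => gsat R V x (τ k)) x' →
        (V x p ↔ V x' p)) →
      (∀ x, Relation.ReflTransGen R y x → Eqv R V0 (z x) (fun x k => gsat R V x (τ k)) x) →
      ∀ x, Relation.ReflTransGen R y x → ∀ p ∈ σ,
        ((∃ x', Relation.ReflTransGen R y x' ∧
          Eqv R V0 (z x) (fun x k => gsat R V x (τ k)) x' ∧ V x' p) ↔ V x p) := by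
    intro V y V0 τ z h1 h2 x hx p hp
    constructor
    · rintro ⟨x', hx', he, hv⟩
      exact (h1 p hp x x' hx hx' ((h2 x hx).symm.trans he)).2 hv
    · intro hv
      exact ⟨x, hx, h2 x hx, hv⟩
  refine ⟨bigOr (idx.toList.map disj), ?_, ?_, ?_, ?_⟩
  · -- signature
    intro a ha
    rw [sig_bigOr] at ha
    obtain ⟨_, ht', ha⟩ := ha
    obtain ⟨t, ht, rfl⟩ := List.mem_map.1 ht'
    rw [Finset.mem_toList, hidx] at ht
    have hτ := fun k => (taus_size ht k).2
    have ho : ∀ p ∈ σ, ∀ o : Option K, (o.elim (MForm.atom p) t.2.2).sig ⊆ σ := by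
      rintro p hp (_ | k)
      · simpa [sig] using hp
      · exact hτ k
    simp only [disj, sig, Finset.mem_union, sig_bigAnd, List.mem_map, Finset.mem_toList] at ha
    rcases ha with ha | ⟨_, ⟨p, hp, rfl⟩, ha⟩ | ha
    · exact sig_subst _ σ hτ _ ha
    · exact sig_subst _ σ (ho p hp) _ ha
    · refine sig_subst _ σ ?_ _ ha
      intro b
      rcases hs2 t.2.1 t.2.2 b with h | ⟨p, hp, w, h⟩
      · rw [h]; simp [sig]
      · rw [h]; exact sig_subst _ σ (ho p hp) _
  · -- `φ → χ`
    intro i V hV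
    rw [gsat_bigOr]
    let τ : K → MForm ℕ := fun k =>
      if h : ∃ p ∈ σ, ¬ (V k.1 p ↔ V k.2 p) then .atom h.choose else .top
    have hτ : τ ∈ taus K σ := by
      refine Fintype.mem_piFinset.2 fun k => ?_
      by_cases h : ∃ p ∈ σ, ¬ (V k.1 p ↔ V k.2 p)
      · simp only [τ, dif_pos h]
        exact Finset.mem_insert_of_mem (Finset.mem_image_of_mem _ h.choose_spec.1)
      · simp only [τ, dif_neg h]
        exact Finset.mem_insert_self _ _
    have hsep : ∀ x x', Eqv R (fun x k => gsat R V x (τ k)) x (fun x k => gsat R V x (τ k)) x' →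
        ∀ p ∈ σ, (V x p ↔ V x' p) := by
      intro x x' he
      by_contra hcon
      push Not at hcon
      have h : ∃ p ∈ σ, ¬ (V x p ↔ V x' p) := by
        obtain ⟨p, hp, h⟩ := hcon
        exact ⟨p, hp, by tauto⟩
      have hk := he (.atom (x, x'))
      simp only [gsat, τ, dif_pos h] at hk
      exact h.choose_spec.2 hk
    refine ⟨_, List.mem_map.2 ⟨(i, (fun x k => gsat R V x (τ k)), τ), ?_, rfl⟩, ?_⟩
    · rw [Finset.mem_toList, hidx]; exact hτ
    · rw [semdisj]
      refine ⟨?_, ?_, ?_⟩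
      · rw [semD]; exact Eqv.refl
      · intro p hp
        rw [semγ]
        intro x x' _ _ he
        exact hsep x x' he p hp
      · rw [semξ]
        refine (psat_imp _ _ _).1 ((hξ1 _ i).2.2.1 _) ?_
        rw [tr_val hc R σ _ V 1 (by decide)]
        · exact hV
        · refine keyΘ V (pt i) _ τ _ (fun p hp x x' _ _ he => hsep x x' he p hp) ?_
          intro x _
          exact (hrep1 _ x).symm
  · -- `χ → ψ`
    intro j V hV
    rw [gsat_bigOr] at hV
    obtain ⟨_, ht, hV⟩ := hV
    obtain ⟨⟨i, V0, τ⟩, ht, rfl⟩ := List.mem_map.1 ht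
    rw [semdisj] at hV
    obtain ⟨h1, h2, h3⟩ := hV
    simp only at h1 h2 h3
    rw [semD] at h1
    rw [semξ] at h3
    have h3 := (psat_imp _ _ _).1 ((hξ1 V0 i).2.2.2 _) h3
    rw [psat_rhs] at h3
    let z : W → W := fun x => if h : ∃ w, Eqv R V0 w (fun x k => gsat R V x (τ k)) x then
      rep V0 h.choose else x
    have hz : ∀ w x, Eqv R V0 w (fun x k => gsat R V x (τ k)) x → z x = rep V0 w := by
      intro w x he
      have h : ∃ w, Eqv R V0 w (fun x k => gsat R V x (τ k)) x := ⟨w, he⟩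
      simp only [z, dif_pos h]
      exact hrep2 _ _ _ (h.choose_spec.trans he.symm)
    have hgood : Good R (rep V0) z (pt i) (pt j) := by
      intro u χ
      refine bisim R R _ _ (fun w x => Eqv R V0 w (fun x k => gsat R V x (τ k)) x)
        (fun x y x' h hr => h.forth hr) (fun x y y' h hr => h.back hr) χ ?_ _ _ h1
      intro w x he a _
      rw [hz w x he]
    have h4 := h3 j z hgood
    rw [tr_val hc R σ _ V 2 (by decide)] at h4
    · exact h4
    · refine keyΘ V (pt j) V0 τ z (fun p hp => (semγ V (pt j) τ p).1 (h2 p hp)) ?_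
      intro x hx
      obtain ⟨w, _, hw⟩ := h1.symm.reach hx
      rw [hz w x hw.symm]
      exact (hrep1 V0 w).symm.trans hw.symm
  · -- size
    have hσn : σ.card ≤ n := by
      have := Finset.card_le_card (Finset.inter_subset_left (s₁ := φ.sig) (s₂ := ψ.sig))
      have := sig_card_le φ
      rw [← hσ] at *
      omega
    have hB : ∀ χ ∈ idx.toList.map disj, χ.dagSize ≤ (4 * C + 4) * (m + 1) := by
      intro χ hχ
      obtain ⟨t, ht, rfl⟩ := List.mem_map.1 hχ
      rw [Finset.mem_toList, hidx] at ht
      have hτ := fun k => (taus_size ht k).1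
      have ho : ∀ p, ∀ o : Option K, (o.elim (MForm.atom p) t.2.2).dagSize ≤ 1 := by
        rintro p (_ | k)
        · simp [dagSize, subf]
        · exact hτ k
      have b1 := dagSize_subst t.2.2 1 hτ (D t.2.1 (pt t.1))
      have b1' := hCD t.2.1 (pt t.1)
      have b2 := dagSize_bigAnd (C * 2) (σ.toList.map (fun p =>
          substAtoms (fun o : Option K => o.elim (MForm.atom p) t.2.2) γ)) (by
        intro χ hχ
        obtain ⟨p, _, rfl⟩ := List.mem_map.1 hχ
        exact (dagSize_subst _ 1 (ho p) γ).trans (Nat.mul_le_mul_right _ hCγ))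
      rw [List.length_map, Finset.length_toList] at b2
      have b3 := dagSize_subst (s t.2.1 t.2.2) (C * 2 + 1) (by
        intro b
        rcases hs2 t.2.1 t.2.2 b with h | ⟨p, hp, w, h⟩
        · rw [h]; simp [dagSize, subf]
        · rw [h]
          refine (dagSize_subst _ 1 (ho p) _).trans ?_
          exact (Nat.mul_le_mul_right _ (hCθ _ _)).trans (Nat.le_succ _)) (ξ t.2.1 t.1)
      have b4 : (ξ t.2.1 t.1).dagSize * (C * 2 + 1 + 1) ≤ m * (C * 2 + 1 + 1) :=
        Nat.mul_le_mul_right _ (hξ2 _ _)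
      have b5 : σ.card * (C * 2 + 1) ≤ m * (C * 2 + 1) :=
        Nat.mul_le_mul_right _ (hσn.trans hnm)
      have b6 := dagSize_and (bigAnd (σ.toList.map (fun p =>
          substAtoms (fun o : Option K => o.elim (MForm.atom p) t.2.2) γ)))
        (substAtoms (s t.2.1 t.2.2) (ξ t.2.1 t.1))
      have b7 : (disj t).dagSize ≤ _ := dagSize_and (substAtoms t.2.2 (D t.2.1 (pt t.1)))
        (.and (bigAnd (σ.toList.map (fun p =>
          substAtoms (fun o : Option K => o.elim (MForm.atom p) t.2.2) γ)))
        (substAtoms (s t.2.1 t.2.2) (ξ t.2.1 t.1)))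
      nlinarith
    refine (dagSize_bigOr _ _ hB).trans ?_
    refine Nat.add_le_add_right (Nat.mul_le_mul_right _ ?_) 2
    rw [List.length_map, Finset.length_toList]
    simp only [idx, Finset.card_product, Finset.card_univ]
    rw [← Nat.mul_assoc]
    refine Nat.mul_le_mul_left _ ((taus_card K σ).trans (Nat.pow_le_pow_left ?_ _))
    omega

/-- The disjoint union of a family of frames. -/
inductive SumR {ι : Type} (Fr : ι → PFin) : (Σ i, (Fr i).W) → (Σ i, (Fr i).W) → Prop
  | mk (i : ι) (x y : (Fr i).W) : (Fr i).R x y → SumR Fr ⟨i, x⟩ ⟨i, y⟩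

theorem mem_Log_iff {ι : Type} (Fr : ι → PFin) (φ : MForm ℕ) :
    φ ∈ Log Fr ↔ ∀ i V, gsat (SumR Fr) V ⟨i, (Fr i).pt⟩ φ := by
  have key : ∀ i (V : (Σ i, (Fr i).W) → ℕ → Prop) x,
      gsat (Fr i).R (fun x => V ⟨i, x⟩) x φ ↔ gsat (SumR Fr) V ⟨i, x⟩ φ := by
    intro i V x
    refine bisim _ _ _ _ (fun x y => y = ⟨i, x⟩) ?_ ?_ φ ?_ _ _ rfl
    · rintro x _ x' rfl h
      exact ⟨_, .mk i x x' h, rfl⟩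
    · rintro x _ y' rfl h
      cases h with
      | mk _ _ y h => exact ⟨y, h, rfl⟩
    · rintro x _ rfl a _
      rfl
  constructor
  · intro h i V
    rw [← key, ← sat_eq_gsat]
    exact h i _
  · intro h i V
    classical
    have := h i (fun z p => ∃ x, z = ⟨i, x⟩ ∧ V x p)
    rw [← key, ← sat_eq_gsat] at this
    convert this
    simp

end TabInt

/-- for a tabular quasi-normal modal logic `L` with CIP there are polynomials
`p`, `q` (depending only on `L`) such that for every monotone `f : ℕ → ℕ`: if every
tautological propositional implication `χ₁→χ₂` has a propositional Craig interpolant of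
dag-size at most `f(|χ₁→χ₂|)`, then every modal implication `φ→ψ ∈ L` has a Craig
interpolant in `L` of dag-size at most `p(f(q(|φ|+|ψ|)))`. -/
theorem stmt14 (L : Set (MForm ℕ)) (hL : Tabular L) (hCIP : HasCIP L) :
    ∃ p q : Polynomial ℕ, ∀ f : ℕ → ℕ, Monotone f →
      (∀ χ₁ χ₂ : MForm ℕ, χ₁.IsProp → χ₂.IsProp → PTaut (χ₁.imp χ₂) →
        ∃ ξ : MForm ℕ, PCraig χ₁ χ₂ ξ ∧ ξ.dagSize ≤ f (χ₁.imp χ₂).dagSize) →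
      ∀ φ ψ : MForm ℕ, φ.imp ψ ∈ L →
        ∃ χ : MForm ℕ, CraigInt L φ ψ χ ∧
          χ.dagSize ≤ p.eval (f (q.eval (φ.dagSize + ψ.dagSize))) := by
  obtain ⟨ι, _, Fr, rfl⟩ := hL
  obtain ⟨p, q, h⟩ := TabInt.core (TabInt.SumR Fr) (fun i : ι => ⟨i, (Fr i).pt⟩)
  refine ⟨p, q, fun f hf hint φ ψ hφψ => ?_⟩
  obtain ⟨χ₀, h1, h2, h3⟩ := hCIP φ ψ hφψ
  simp only [TabInt.mem_Log_iff, TabInt.gsat_imp] at h1 h2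
  obtain ⟨χ, g1, g2, g3, g4⟩ := h f hf hint φ ψ χ₀ h3 h1 h2
  refine ⟨χ, ⟨?_, ?_, g1⟩, g4⟩
  · simpa only [TabInt.mem_Log_iff, TabInt.gsat_imp] using g2
  · simpa only [TabInt.mem_Log_iff, TabInt.gsat_imp] using g3
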